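/- Let Ψ and Z be n×K matrices with entries in {0,1} having exactly one 1 per row, and let A′ be a symmetric n×n matrix with nonnegative entries such that every row sum of A′ is at most C₀d. Then |Σ_{i<j} Σ_{a=1}^K Ψ_{ia}Ψ_{ja}A′_{ij} − Σ_{i<j} Σ_{a=1}^K Z_{ia}Z_{ja}A′_{ij}| ≤ 3‖Ψ − Z‖_1·C₀d, where ‖M‖_1 = Σ_{i,j}|M_{ij}|. -/

import Mathlib

open Finset

/-- For vectors with entries bounded by `1`, inner products are `ℓ₁`-Lipschitz in each argument. -/
theorem abs_sum_mul_sub_sum_mul_le {ι : Type*} [Fintype ι] (u v x y : ι → ℝ)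
    (hv : ∀ a, |v a| ≤ 1) (hx : ∀ a, |x a| ≤ 1) :
    |∑ a, u a * v a - ∑ a, x a * y a| ≤ ∑ a, |u a - x a| + ∑ a, |v a - y a| := by
  rw [← sum_sub_distrib, ← sum_add_distrib]
  refine (abs_sum_le_sum_abs _ _).trans (sum_le_sum fun a _ => ?_)
  calc |u a * v a - x a * y a| = |(u a - x a) * v a + x a * (v a - y a)| := by ring_nf
    _ ≤ |u a - x a| * |v a| + |x a| * |v a - y a| := by
        simpa only [abs_mul] using abs_add_le ((u a - x a) * v a) (x a * (v a - y a))
    _ ≤ |u a - x a| + |v a - y a| :=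
        add_le_add (mul_le_of_le_one_right (abs_nonneg _) (hv a))
          (mul_le_of_le_one_left (abs_nonneg _) (hx a))

/-- **Deterministic ℓ₁ perturbation bound for regularized quadratic forms.**
Let `Ψ` and `Z` be `n × K` membership matrices (entries in `{0,1}`, exactly one `1` per
row) and let `A′` be a symmetric `n × n` matrix with nonnegative entries whose row sums
are at most `C₀ d`.  Then
`|Σ_{i<j} Σ_a Ψ_{ia} Ψ_{ja} A′_{ij} − Σ_{i<j} Σ_a Z_{ia} Z_{ja} A′_{ij}| ≤ 3 ‖Ψ − Z‖₁ C₀ d`,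
where `‖M‖₁ = Σ_{i,a} |M_{ia}|`. -/
theorem stmt_13
    (n K : ℕ) (C₀ d : ℝ)
    (Ψ Z : Fin n → Fin K → ℝ)
    (hΨ01 : ∀ i a, Ψ i a = 0 ∨ Ψ i a = 1)
    (hZ01 : ∀ i a, Z i a = 0 ∨ Z i a = 1)
    (hΨrow : ∀ i, ∑ a : Fin K, Ψ i a = 1)
    (hZrow : ∀ i, ∑ a : Fin K, Z i a = 1)
    (A' : Fin n → Fin n → ℝ)
    (hA'sym : ∀ i j, A' i j = A' j i)
    (hA'nonneg : ∀ i j, 0 ≤ A' i j)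
    (hA'deg : ∀ i, (∑ j : Fin n, A' i j) ≤ C₀ * d) :
    |(∑ i : Fin n, ∑ j : Fin n, if i < j then
        (∑ a : Fin K, Ψ i a * Ψ j a) * A' i j else 0) -
     (∑ i : Fin n, ∑ j : Fin n, if i < j then
        (∑ a : Fin K, Z i a * Z j a) * A' i j else 0)| ≤
      3 * (∑ i : Fin n, ∑ a : Fin K, |Ψ i a - Z i a|) * (C₀ * d) := by
  set δ : Fin n → ℝ := fun i => ∑ a, |Ψ i a - Z i a|
  have hδ : ∀ i, 0 ≤ δ i := fun i => sum_nonneg fun a _ => abs_nonneg _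
  have hΨ1 : ∀ i a, |Ψ i a| ≤ 1 := fun i a => by rcases hΨ01 i a with h | h <;> simp [h]
  have hZ1 : ∀ i a, |Z i a| ≤ 1 := fun i a => by rcases hZ01 i a with h | h <;> simp [h]
  have hdeg : ∑ i, ∑ j, δ i * A' i j ≤ (∑ i, δ i) * (C₀ * d) := by
    rw [sum_mul]
    refine sum_le_sum fun i _ => ?_
    rw [← mul_sum]
    exact mul_le_mul_of_nonneg_left (hA'deg i) (hδ i)
  have hnonneg : 0 ≤ ∑ i, ∑ j, δ i * A' i j :=
    sum_nonneg fun i _ => sum_nonneg fun j _ => mul_nonneg (hδ i) (hA'nonneg i j)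
  have hswap : ∑ i, ∑ j, δ j * A' i j = ∑ i, ∑ j, δ i * A' i j := by
    rw [sum_comm]
    simp only [hA'sym]
  have hbound : ∀ i j, |(if i < j then (∑ a, Ψ i a * Ψ j a) * A' i j else 0) -
      (if i < j then (∑ a, Z i a * Z j a) * A' i j else 0)| ≤
      δ i * A' i j + δ j * A' i j := by
    intro i j
    split_ifs
    · rw [← sub_mul, abs_mul, abs_of_nonneg (hA'nonneg i j), ← add_mul]
      exact mul_le_mul_of_nonneg_right
        (abs_sum_mul_sub_sum_mul_le _ _ _ _ (hΨ1 j) (hZ1 i)) (hA'nonneg i j)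
    · rw [sub_zero, abs_zero, ← add_mul]
      exact mul_nonneg (add_nonneg (hδ i) (hδ j)) (hA'nonneg i j)
  simp only [← sum_sub_distrib]
  refine ((abs_sum_le_sum_abs _ _).trans (sum_le_sum fun i _ =>
    (abs_sum_le_sum_abs _ _).trans (sum_le_sum fun j _ => hbound i j))).trans ?_
  simp only [sum_add_distrib]
  rw [hswap]
  linarith
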